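/- Define weights on strong Bruhat covers of S_n by wt(v ⋖ w) = 1 + b_{v⋖w}(2−z) + c_{v⋖w}·z (a polynomial in z), where for a cover v ⋖ v·t_{ij} (i<j), b = #{k : i<k<j, v(k)>v(j)} and c = #{k>j : v(i)<v(k)<v(j)}. Then for any w ∈ S_n, the weighted sum over all saturated chains from w to the longest element w₀ (weight of a chain = product of edge weights) equals (C(n,2) − ℓ(w))!·𝔖_w(1,...,1); in particular it is independent of z. -/

import Mathlib

open Equiv Finset
open scoped Classical

/-- Number of inversions (Coxeter length) of a permutation of `Fin n`. -/
def invCount {n : ℕ} (v : Equiv.Perm (Fin n)) : ℕ :=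
  (Finset.univ.filter (fun p : Fin n × Fin n => p.1 < p.2 ∧ v p.2 < v p.1)).card

/-- `a` statistic of a (candidate) cover `v ⋖ v·t_{ij}`. -/
def aQ {n : ℕ} (v : Equiv.Perm (Fin n)) (i j : Fin n) : ℕ :=
  (Finset.univ.filter (fun k : Fin n => k < i ∧ v i < v k ∧ v k < v j)).card

/-- `b` statistic. -/
def bQ {n : ℕ} (v : Equiv.Perm (Fin n)) (i j : Fin n) : ℕ :=
  (Finset.univ.filter (fun k : Fin n => i < k ∧ k < j ∧ v j < v k)).card

/-- `c` statistic. -/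
def cQ {n : ℕ} (v : Equiv.Perm (Fin n)) (i j : Fin n) : ℕ :=
  (Finset.univ.filter (fun k : Fin n => j < k ∧ v i < v k ∧ v k < v j)).card

/-- `d` statistic. -/
def dQ {n : ℕ} (v : Equiv.Perm (Fin n)) (i j : Fin n) : ℕ :=
  (Finset.univ.filter (fun k : Fin n => i < k ∧ k < j ∧ v k < v i)).card

/-- Covering relation in strong Bruhat order. -/
def BruhatCov {n : ℕ} (v w : Equiv.Perm (Fin n)) : Prop :=
  ∃ i j : Fin n, i < j ∧ w = v * Equiv.swap i j ∧ invCount w = invCount v + 1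

/-- The adjacent transposition `s_{a+1} = (a+1, a+2)` of `Fin (n+1)` (0-indexed positions `a, a+1`),
for `a : Fin n`. -/
def adjTransp {n : ℕ} (a : Fin n) : Equiv.Perm (Fin (n + 1)) :=
  Equiv.swap a.castSucc a.succ

/-- Principal specialization `𝔖_u(1,...,1)` of the Schubert polynomial, defined via
Macdonald's reduced word identity:
`𝔖_u(1,…,1) = (1/ℓ(u)!) ∑_{reduced words (a_1,…,a_ℓ) of u} a_1 ⋯ a_ℓ`. -/
noncomputable def prinSpec {n : ℕ} (u : Equiv.Perm (Fin (n + 1))) : ℚ :=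
  (∑ a ∈ Finset.univ.filter
      (fun a : Fin (invCount u) → Fin n =>
        (List.ofFn (fun i => adjTransp (a i))).prod = u),
    ∏ i, ((a i : ℕ) + 1 : ℚ)) / (invCount u).factorial

/-- Weighted count of saturated chains from `v` to `w` in strong Bruhat order:
a saturated chain is a sequence `v = c 0 ⋖ c 1 ⋖ ⋯ ⋖ c m = w` of covers
(its length is necessarily `m = ℓ(w) - ℓ(v)`), and the weight of a chain is the
product of the weights of its covering steps. -/
noncomputable def chainSum {n : ℕ} {R : Type*} [CommSemiring R]
    (wt : Equiv.Perm (Fin n) → Equiv.Perm (Fin n) → R)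
    (v w : Equiv.Perm (Fin n)) : R :=
  ∑ c ∈ Finset.univ.filter
      (fun c : Fin (invCount w - invCount v + 1) → Equiv.Perm (Fin n) =>
        c 0 = v ∧ c (Fin.last _) = w ∧
          ∀ i : Fin (invCount w - invCount v), BruhatCov (c i.castSucc) (c i.succ)),
    ∏ i : Fin (invCount w - invCount v), wt (c i.castSucc) (c i.succ)

open Polynomial in
/-- The weight `1 + b(2 - z) + c z ∈ ℚ[z]` of a cover `v ⋖ u = v·t_{ij}`. -/
noncomputable def wtBC {n : ℕ} (v u : Equiv.Perm (Fin n)) : Polynomial ℚ :=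
  ∑ p ∈ Finset.univ.filter
      (fun p : Fin n × Fin n => p.1 < p.2 ∧ u = v * Equiv.swap p.1 p.2),
    (1 + (bQ v p.1 p.2 : Polynomial ℚ) * (2 - X) + (cQ v p.1 p.2 : Polynomial ℚ) * X)


section BruhatLength

variable {n : ℕ}

theorem adjTransp_mul_self (k : Fin n) : adjTransp k * adjTransp k = 1 :=
  Equiv.swap_mul_self _ _

theorem adjTransp_mul_adjTransp_mul (k : Fin n) (w : Equiv.Perm (Fin (n + 1))) :
    adjTransp k * (adjTransp k * w) = w := by
  rw [← mul_assoc, adjTransp_mul_self, one_mul]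

theorem adjTransp_inv (k : Fin n) : (adjTransp k)⁻¹ = adjTransp k :=
  Equiv.swap_inv _ _

theorem swap_eq_swap_mul_swap_mul_swap {α : Type*} [DecidableEq α] {i j m : α}
    (hij : i ≠ j) (hmj : m ≠ j) :
    Equiv.swap i j = Equiv.swap i m * Equiv.swap m j * Equiv.swap i m := by
  rw [Equiv.swap_comm i m, Equiv.swap_comm m j,
    Equiv.swap_mul_swap_mul_swap hmj.symm hij.symm]

theorem adjTransp_lt_adjTransp (k : Fin n) {p q : Fin (n + 1)} (h : p < q)
    (hne : ¬ (p = k.castSucc ∧ q = k.succ)) : adjTransp k p < adjTransp k q := by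
  simp only [Fin.ext_iff, Fin.lt_def, Fin.val_castSucc, Fin.val_succ] at h hne ⊢
  simp only [adjTransp, Equiv.swap_apply_def]
  split_ifs <;> simp only [Fin.ext_iff, Fin.val_castSucc, Fin.val_succ] at * <;> omega

theorem invCount_inv {n : ℕ} (w : Equiv.Perm (Fin n)) : invCount w⁻¹ = invCount w := by
  unfold invCount
  refine Finset.card_bij' (fun p _ => (w⁻¹ p.2, w⁻¹ p.1)) (fun p _ => (w p.2, w p.1))
    ?_ ?_ ?_ ?_ <;>
    simp +contextual

theorem invCount_mul_adjTransp_of_lt (w : Equiv.Perm (Fin (n + 1))) (k : Fin n)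
    (h : w k.castSucc < w k.succ) : invCount (w * adjTransp k) = invCount w + 1 := by
  have hk : (k.castSucc, k.succ) ∈ Finset.univ.filter (fun p : Fin (n + 1) × Fin (n + 1) =>
      p.1 < p.2 ∧ (w * adjTransp k) p.2 < (w * adjTransp k) p.1) := by
    rw [Finset.mem_filter]
    simp [adjTransp, h]
  unfold invCount
  rw [← Finset.card_erase_add_one hk]
  congr 1
  have hs : ∀ x, adjTransp k (adjTransp k x) = x := fun x => Equiv.swap_apply_self _ _ x
  refine Finset.card_bij' (fun p _ => (adjTransp k p.1, adjTransp k p.2))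
    (fun p _ => (adjTransp k p.1, adjTransp k p.2)) ?_ ?_ ?_ ?_
  · rintro ⟨p, q⟩ hp
    rw [Finset.mem_erase, Finset.mem_filter] at hp
    rw [Finset.mem_filter]
    simp only [Finset.mem_univ, true_and, ne_eq, Prod.mk.injEq, Equiv.Perm.mul_apply] at hp ⊢
    exact ⟨adjTransp_lt_adjTransp k hp.2.1 hp.1, hp.2.2⟩
  · rintro ⟨p, q⟩ hp
    rw [Finset.mem_filter] at hp
    rw [Finset.mem_erase, Finset.mem_filter]
    simp only [Finset.mem_univ, true_and, ne_eq, Prod.mk.injEq, Equiv.Perm.mul_apply, hs] at hp ⊢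
    refine ⟨?_, adjTransp_lt_adjTransp k hp.1 ?_, hp.2⟩
    · rintro ⟨h1, h2⟩
      have h3 := hs p
      have h4 := hs q
      rw [h1] at h3
      rw [h2] at h4
      simp only [adjTransp, Equiv.swap_apply_left, Equiv.swap_apply_right] at h3 h4
      rw [← h3, ← h4] at hp
      exact absurd hp.1 (by simp [Fin.lt_def])
    · rintro ⟨rfl, rfl⟩
      exact absurd hp.2 (not_lt.2 h.le)
  · simp [hs]
  · simp [hs]

theorem invCount_mul_adjTransp_of_gt (w : Equiv.Perm (Fin (n + 1))) (k : Fin n)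
    (h : w k.succ < w k.castSucc) : invCount (w * adjTransp k) + 1 = invCount w := by
  have := invCount_mul_adjTransp_of_lt (w * adjTransp k) k (by simpa [adjTransp] using h)
  rw [mul_assoc, adjTransp_mul_self, mul_one] at this
  exact this.symm

theorem invCount_adjTransp_mul (w : Equiv.Perm (Fin (n + 1))) (k : Fin n) :
    invCount (adjTransp k * w) = invCount (w⁻¹ * adjTransp k) := by
  rw [← invCount_inv, mul_inv_rev, adjTransp_inv]

theorem inv_castSucc_ne_inv_succ (w : Equiv.Perm (Fin (n + 1))) (k : Fin n) :
    w⁻¹ k.castSucc ≠ w⁻¹ k.succ := by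
  simp [Fin.ext_iff]

theorem invCount_adjTransp_mul_of_lt (w : Equiv.Perm (Fin (n + 1))) (k : Fin n)
    (h : w⁻¹ k.castSucc < w⁻¹ k.succ) : invCount (adjTransp k * w) = invCount w + 1 := by
  rw [invCount_adjTransp_mul, invCount_mul_adjTransp_of_lt _ _ h, invCount_inv]

theorem invCount_adjTransp_mul_of_gt (w : Equiv.Perm (Fin (n + 1))) (k : Fin n)
    (h : w⁻¹ k.succ < w⁻¹ k.castSucc) : invCount (adjTransp k * w) + 1 = invCount w := by
  rw [invCount_adjTransp_mul, invCount_mul_adjTransp_of_gt _ _ h, invCount_inv]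

theorem invCount_adjTransp_mul_eq_add_one_iff (w : Equiv.Perm (Fin (n + 1))) (k : Fin n) :
    invCount (adjTransp k * w) = invCount w + 1 ↔ w⁻¹ k.castSucc < w⁻¹ k.succ := by
  refine ⟨fun h => ?_, invCount_adjTransp_mul_of_lt w k⟩
  by_contra h'
  have := invCount_adjTransp_mul_of_gt w k
    (lt_of_le_of_ne (not_lt.1 h') (inv_castSucc_ne_inv_succ w k).symm)
  omega

theorem invCount_adjTransp_mul_add_one_eq_iff (w : Equiv.Perm (Fin (n + 1))) (k : Fin n) :
    invCount (adjTransp k * w) + 1 = invCount w ↔ w⁻¹ k.succ < w⁻¹ k.castSucc := by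
  refine ⟨fun h => ?_, invCount_adjTransp_mul_of_gt w k⟩
  by_contra h'
  have := invCount_adjTransp_mul_of_lt w k
    (lt_of_le_of_ne (not_lt.1 h') (inv_castSucc_ne_inv_succ w k))
  omega

theorem invCount_adjTransp_mul_cases (w : Equiv.Perm (Fin (n + 1))) (k : Fin n) :
    invCount (adjTransp k * w) = invCount w + 1 ∨ invCount (adjTransp k * w) + 1 = invCount w := by
  rw [invCount_adjTransp_mul_eq_add_one_iff, invCount_adjTransp_mul_add_one_eq_iff]
  exact lt_or_gt_of_ne (inv_castSucc_ne_inv_succ w k)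

theorem invCount_lt_invCount_mul_swap (w : Equiv.Perm (Fin (n + 1))) (i j : Fin (n + 1))
    (hij : i < j) (h : w i < w j) : invCount w < invCount (w * Equiv.swap i j) := by
  obtain ⟨d, hd⟩ : ∃ d, (j : ℕ) = i + d + 1 := ⟨j - i - 1, by rw [Fin.lt_def] at hij; omega⟩
  induction d generalizing i w with
  | zero =>
    have hi : (i : ℕ) < n := by omega
    have hj : j = (⟨i, hi⟩ : Fin n).succ := Fin.ext hd
    have := invCount_mul_adjTransp_of_lt w ⟨i, hi⟩ (by rw [← hj]; exact h)
    rw [adjTransp, ← hj] at this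
    exact Nat.lt_of_succ_le this.ge
  | succ d ih =>
    have hi : (i : ℕ) < n := by omega
    set k : Fin n := ⟨i, hi⟩ with hk
    have hki : k.castSucc = i := rfl
    have hks : k.succ < j := by rw [Fin.lt_def, Fin.val_succ]; simp only [hk]; omega
    have hii : i ≠ k.succ := by rw [← hki]; simp [Fin.ext_iff]
    have hsw : w * Equiv.swap i j
        = w * adjTransp k * Equiv.swap k.succ j * adjTransp k := by
      rw [adjTransp, hki, mul_assoc, mul_assoc, ← mul_assoc (Equiv.swap i k.succ),
        swap_eq_swap_mul_swap_mul_swap hij.ne hks.ne]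
    have hmid := ih (w * adjTransp k) k.succ hks (by
      rw [Equiv.Perm.mul_apply, Equiv.Perm.mul_apply, adjTransp, Equiv.swap_apply_right,
        Equiv.swap_apply_of_ne_of_ne (by rw [hki]; exact hij.ne') hks.ne', hki]
      exact h) (by simp only [hk, Fin.val_succ]; omega)
    have hne : w k.castSucc ≠ w k.succ := by simp [Fin.ext_iff]
    have e1 : (w * adjTransp k * Equiv.swap k.succ j) k.castSucc = w k.succ := by
      rw [Equiv.Perm.mul_apply, Equiv.swap_apply_of_ne_of_ne (by rw [hki]; exact hii)
        (by rw [hki]; exact hij.ne), Equiv.Perm.mul_apply, adjTransp, Equiv.swap_apply_left]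
    have e2 : (w * adjTransp k * Equiv.swap k.succ j) k.succ = w j := by
      rw [Equiv.Perm.mul_apply, Equiv.swap_apply_left, Equiv.Perm.mul_apply, adjTransp,
        Equiv.swap_apply_of_ne_of_ne (by rw [hki]; exact hij.ne') hks.ne']
    have hne2 : w k.succ ≠ w j := by simpa using hks.ne
    rw [hsw]
    rcases lt_or_gt_of_ne hne with h1 | h1
    · have s1 := invCount_mul_adjTransp_of_lt w k h1
      rcases lt_or_gt_of_ne hne2 with h2 | h2
      · have s2 := invCount_mul_adjTransp_of_lt _ k (by rw [e1, e2]; exact h2)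
        omega
      · have s2 := invCount_mul_adjTransp_of_gt _ k (by rw [e1, e2]; exact h2)
        omega
    · have s1 := invCount_mul_adjTransp_of_gt w k h1
      have s2 := invCount_mul_adjTransp_of_lt _ k (by
        rw [e1, e2]; exact h1.trans (by rw [hki]; exact h))
      omega

theorem lt_of_invCount_mul_swap (w : Equiv.Perm (Fin (n + 1))) (i j : Fin (n + 1))
    (hij : i < j) (h : invCount (w * Equiv.swap i j) = invCount w + 1) : w i < w j := by
  by_contra hc
  have hlt : w j < w i := lt_of_le_of_ne (not_lt.1 hc) (by simpa using hij.ne')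
  have := invCount_lt_invCount_mul_swap (w * Equiv.swap i j) i j hij (by simpa using hlt)
  rw [mul_assoc, Equiv.swap_mul_self, mul_one] at this
  omega

theorem not_between_of_invCount_mul_swap (w : Equiv.Perm (Fin (n + 1))) (i j m : Fin (n + 1))
    (h : invCount (w * Equiv.swap i j) = invCount w + 1)
    (him : i < m) (hmj : m < j) : ¬ (w i < w m ∧ w m < w j) := by
  rintro ⟨h1, h2⟩
  have hij := him.trans hmj
  have hsw : w * Equiv.swap i j
      = w * Equiv.swap i m * Equiv.swap m j * Equiv.swap i m := by
    rw [mul_assoc, mul_assoc, ← mul_assoc (Equiv.swap i m),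
      swap_eq_swap_mul_swap_mul_swap hij.ne hmj.ne]
  have s1 := invCount_lt_invCount_mul_swap w i m him h1
  have s2 := invCount_lt_invCount_mul_swap (w * Equiv.swap i m) m j hmj (by
    rw [Equiv.Perm.mul_apply, Equiv.Perm.mul_apply, Equiv.swap_apply_right,
      Equiv.swap_apply_of_ne_of_ne hij.ne' hmj.ne']
    exact h1.trans h2)
  have s3 := invCount_lt_invCount_mul_swap (w * Equiv.swap i m * Equiv.swap m j) i m him (by
    rw [Equiv.Perm.mul_apply, Equiv.swap_apply_of_ne_of_ne him.ne hij.ne,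
      Equiv.Perm.mul_apply, Equiv.swap_apply_left, Equiv.Perm.mul_apply, Equiv.swap_apply_left,
      Equiv.Perm.mul_apply, Equiv.swap_apply_of_ne_of_ne hij.ne' hmj.ne']
    exact h2)
  rw [← hsw] at s3
  omega

/-- The lifting property for covers in the Bruhat order. -/
theorem adjTransp_mul_eq_mul_swap (w : Equiv.Perm (Fin (n + 1))) (k : Fin n) (i j : Fin (n + 1))
    (hij : i < j) (h : invCount (w * Equiv.swap i j) = invCount w + 1)
    (hk : invCount (adjTransp k * w) = invCount w + 1)
    (hb : invCount (adjTransp k * (w * Equiv.swap i j)) = invCount w) :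
    adjTransp k * w = w * Equiv.swap i j := by
  have hw := lt_of_invCount_mul_swap w i j hij h
  rw [invCount_adjTransp_mul_eq_add_one_iff] at hk
  have hb' : invCount (adjTransp k * (w * Equiv.swap i j)) + 1 = invCount (w * Equiv.swap i j) := by
    omega
  rw [invCount_adjTransp_mul_add_one_eq_iff, mul_inv_rev, Equiv.swap_inv, Equiv.Perm.mul_apply,
    Equiv.Perm.mul_apply] at hb'
  have hbet := fun m => not_between_of_invCount_mul_swap w i j m h
  obtain ⟨p, hp⟩ : ∃ p, p = w⁻¹ k.castSucc := ⟨_, rfl⟩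
  obtain ⟨q, hq⟩ : ∃ q, q = w⁻¹ k.succ := ⟨_, rfl⟩
  rw [← hp, ← hq] at hk hb'
  have hwp : w p = k.castSucc := by simp [hp]
  have hwq : w q = k.succ := by simp [hq]
  by_cases hpq : p = i ∧ q = j
  · rw [← hpq.1, ← hpq.2, Equiv.mul_swap_eq_swap_mul, hwp, hwq, adjTransp]
  · exfalso
    clear hp hq h hb
    have inj : ∀ a b, a ≠ b → (w a : ℕ) ≠ w b := fun a b hab hc => hab (w.injective (Fin.ext hc))
    have hwp' : (w p : ℕ) = k := by simp [hwp]
    have hwq' : (w q : ℕ) = k + 1 := by simp [hwq]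
    clear hwp hwq
    rw [Fin.lt_def] at hw
    rcases eq_or_ne p i with rfl | hpi
    · have hqj : q ≠ j := fun hc => hpq ⟨rfl, hc⟩
      rw [Equiv.swap_apply_left, Equiv.swap_apply_of_ne_of_ne hk.ne' hqj] at hb'
      have h1 := hbet q hk hb'
      have h2 := inj q j hqj
      rw [Fin.lt_def, Fin.lt_def] at h1
      omega
    · rcases eq_or_ne q j with rfl | hqj
      · rw [Equiv.swap_apply_right, Equiv.swap_apply_of_ne_of_ne hpi hk.ne] at hb'
        have h1 := hbet p hb' hk
        have h2 := inj p i hpi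
        rw [Fin.lt_def, Fin.lt_def] at h1
        omega
      · rw [Equiv.swap_apply_def, Equiv.swap_apply_def, if_neg hqj, if_neg hpi] at hb'
        split_ifs at hb' with h1 h2 h2
        · exact absurd hb' (not_lt.2 hij.le)
        · subst h1
          exact absurd (hb'.trans hk) (not_lt.2 hij.le)
        · subst h2
          exact absurd (hk.trans hb') (not_lt.2 hij.le)
        · exact absurd hb' (not_lt.2 hk.le)

end BruhatLength

section WordSum

variable {n : ℕ}

/-- The sum of `a_1 ⋯ a_m` over all words `(a_1, …, a_m)` in the adjacent transpositions
with product `w`. -/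
noncomputable def wordSum (m : ℕ) (w : Equiv.Perm (Fin (n + 1))) : ℚ :=
  ∑ a : Fin m → Fin n,
    if (List.ofFn (fun i => adjTransp (a i))).prod = w then ∏ i, ((a i : ℕ) + 1 : ℚ) else 0

theorem prinSpec_eq_wordSum_div (w : Equiv.Perm (Fin (n + 1))) :
    prinSpec w = wordSum (invCount w) w / (invCount w).factorial := by
  rw [prinSpec, wordSum, Finset.sum_filter]

theorem wordSum_zero (w : Equiv.Perm (Fin (n + 1))) :
    wordSum 0 w = if w = 1 then 1 else 0 := by
  simp [wordSum, eq_comm]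

theorem wordSum_succ (m : ℕ) (w : Equiv.Perm (Fin (n + 1))) :
    wordSum (m + 1) w = ∑ k : Fin n, ((k : ℕ) + 1 : ℚ) * wordSum m (adjTransp k * w) := by
  unfold wordSum
  rw [← (Fin.consEquiv (fun _ : Fin (m + 1) => Fin n)).sum_comp, Fintype.sum_prod_type]
  refine Finset.sum_congr rfl fun k _ => ?_
  rw [Finset.mul_sum]
  refine Finset.sum_congr rfl fun a _ => ?_
  have : (adjTransp k * (List.ofFn fun i => adjTransp (a i)).prod = w) ↔
      (List.ofFn fun i => adjTransp (a i)).prod = adjTransp k * w := by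
    constructor
    · rintro rfl
      rw [adjTransp_mul_adjTransp_mul]
    · intro h
      rw [h, adjTransp_mul_adjTransp_mul]
  simp only [Fin.consEquiv_apply, List.ofFn_succ, Fin.cons_zero, Fin.cons_succ, List.prod_cons,
    Fin.prod_univ_succ, mul_ite, mul_zero, this]

theorem wordSum_succ' (m : ℕ) (w : Equiv.Perm (Fin (n + 1))) :
    wordSum (m + 1) w = ∑ k : Fin n, ((k : ℕ) + 1 : ℚ) * wordSum m (w * adjTransp k) := by
  induction m generalizing w with
  | zero =>
    rw [wordSum_succ]
    refine Finset.sum_congr rfl fun k _ => ?_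
    have : adjTransp k * w = 1 ↔ w * adjTransp k = 1 := by
      rw [mul_eq_one_iff_eq_inv, mul_eq_one_iff_eq_inv', eq_comm]
    simp only [wordSum_zero, this]
  | succ m ih =>
    rw [wordSum_succ]
    conv_lhs => simp only [ih]
    conv_rhs => simp only [wordSum_succ m]
    simp only [Finset.mul_sum, mul_assoc]
    rw [Finset.sum_comm]
    refine Finset.sum_congr rfl fun k _ => Finset.sum_congr rfl fun l _ => by ring

theorem wordSum_inv (m : ℕ) (w : Equiv.Perm (Fin (n + 1))) :
    wordSum m w⁻¹ = wordSum m w := by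
  induction m generalizing w with
  | zero => simp [wordSum_zero]
  | succ m ih =>
    rw [wordSum_succ, wordSum_succ']
    refine Finset.sum_congr rfl fun k _ => ?_
    rw [← ih (w * adjTransp k), mul_inv_rev, adjTransp_inv]

theorem invCount_one : invCount (1 : Equiv.Perm (Fin n)) = 0 := by
  unfold invCount
  rw [Finset.card_eq_zero, Finset.filter_eq_empty_iff]
  rintro ⟨p, q⟩ _
  simpa using fun h : p < q => h.le

theorem wordSum_eq_zero (m : ℕ) (w : Equiv.Perm (Fin (n + 1))) (h : m < invCount w) :
    wordSum m w = 0 := by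
  induction m generalizing w with
  | zero =>
    rw [wordSum_zero, if_neg]
    rintro rfl
    rw [invCount_one] at h
    exact lt_irrefl _ h
  | succ m ih =>
    rw [wordSum_succ]
    refine Finset.sum_eq_zero fun k _ => ?_
    rw [ih, mul_zero]
    rcases invCount_adjTransp_mul_cases w k with h1 | h1 <;> omega

/-- The sum of `a_1 ⋯ a_ℓ` over the reduced words of `w`. -/
noncomputable def reducedWordSum (w : Equiv.Perm (Fin (n + 1))) : ℚ :=
  wordSum (invCount w) w

theorem reducedWordSum_inv (w : Equiv.Perm (Fin (n + 1))) :
    reducedWordSum w⁻¹ = reducedWordSum w := by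
  rw [reducedWordSum, invCount_inv, wordSum_inv, reducedWordSum]

theorem reducedWordSum_eq_sum (w : Equiv.Perm (Fin (n + 1))) (hw : invCount w ≠ 0) :
    reducedWordSum w = ∑ k : Fin n, if invCount (adjTransp k * w) + 1 = invCount w then
      ((k : ℕ) + 1 : ℚ) * reducedWordSum (adjTransp k * w) else 0 := by
  obtain ⟨m, hm⟩ := Nat.exists_eq_succ_of_ne_zero hw
  rw [reducedWordSum, hm, Nat.succ_eq_add_one, wordSum_succ]
  refine Finset.sum_congr rfl fun k _ => ?_
  split_ifs with h
  · rw [reducedWordSum, Nat.succ.inj h]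
  · rw [wordSum_eq_zero, mul_zero]
    rcases invCount_adjTransp_mul_cases w k with h1 | h1 <;> omega

theorem eq_one_of_forall_lt (w : Equiv.Perm (Fin (n + 1)))
    (h : ∀ k : Fin n, w k.castSucc < w k.succ) : w = 1 := by
  have hs : StrictMono w := Fin.strictMono_iff_lt_succ.2 h
  have := Subsingleton.elim (hs.orderIsoOfSurjective w w.surjective) (OrderIso.refl _)
  ext x
  exact congrArg Fin.val (congrArg (fun f : Fin (n + 1) ≃o Fin (n + 1) => f x) this)

theorem reducedWordSum_pos (w : Equiv.Perm (Fin (n + 1))) : 0 < reducedWordSum w := by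
  induction hm : invCount w using Nat.strong_induction_on generalizing w with
  | _ m ih =>
  have key : ∀ k : Fin n, 0 ≤ (if invCount (adjTransp k * w) + 1 = invCount w then
      ((k : ℕ) + 1 : ℚ) * reducedWordSum (adjTransp k * w) else 0) := by
    intro k
    split_ifs with h
    · exact mul_nonneg (by positivity) (ih _ (by omega) _ rfl).le
    · exact le_rfl
  by_cases hw : ∀ k : Fin n, w⁻¹ k.castSucc < w⁻¹ k.succ
  · have := inv_eq_one.1 (eq_one_of_forall_lt w⁻¹ hw)
    subst this
    rw [reducedWordSum, invCount_one, wordSum_zero, if_pos rfl]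
    exact one_pos
  · push Not at hw
    obtain ⟨k, hk⟩ := hw
    have hk' := (invCount_adjTransp_mul_add_one_eq_iff w k).2
      (lt_of_le_of_ne hk (inv_castSucc_ne_inv_succ w k).symm)
    rw [reducedWordSum_eq_sum w (by omega)]
    refine Finset.sum_pos' (fun k _ => key k) ⟨k, Finset.mem_univ _, ?_⟩
    rw [if_pos hk']
    exact mul_pos (by positivity) (ih _ (by omega) _ rfl)

end WordSum

section NilCoxeter

open Polynomial

/-- The relations of the nilCoxeter algebra of type `A`. -/
structure IsNilCoxeter {R : Type*} [Ring R] (u : ℕ → R) : Prop where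
  sq : ∀ k, u k * u k = 0
  comm : ∀ k l, k + 2 ≤ l → u k * u l = u l * u k
  braid : ∀ k, u k * u (k + 1) * u k = u (k + 1) * u k * u (k + 1)

variable {R : Type*} [Ring R]

theorem IsNilCoxeter.shift {u : ℕ → R} (h : IsNilCoxeter u) :
    IsNilCoxeter (fun k => u (k + 1)) :=
  ⟨fun k => h.sq _, fun k l hkl => h.comm _ _ (by omega), fun k => h.braid _⟩

/-- The product `(1 + u_{m-1} X) ⋯ (1 + u_0 X)`. -/
noncomputable def nilFactor (u : ℕ → R) : ℕ → R[X]
  | 0 => 1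
  | m + 1 => (1 + C (u m) * X) * nilFactor u m

/-- The Fomin–Stanley product of the factors `nilFactor`. -/
noncomputable def nilProduct (u : ℕ → R) : ℕ → R[X]
  | 0 => 1
  | m + 1 => nilFactor u (m + 1) * nilProduct (fun k => u (k + 1)) m

theorem commute_nilFactor (u : ℕ → R) (h : IsNilCoxeter u) (m l : ℕ) (hl : m + 1 ≤ l) :
    Commute (C (u l)) (nilFactor u m) := by
  induction m with
  | zero => exact Commute.one_right _
  | succ m ih =>
    refine Commute.mul_right ((Commute.one_right _).add_right (Commute.mul_right ?_ ?_))
      (ih (by omega))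
    · exact (show Commute (u m) (u l) from h.comm m l (by omega)).symm.map C
    · exact (commute_X _).symm

theorem nilCoxeter_exchange (a b x c T B : R) (hx : ∀ p, Commute x p) (hc : ∀ p, Commute c p)
    (hT : Commute b T) (hB : Commute b B) (haa : a * a = 0) (hbb : b * b = 0)
    (hab : a * b * a = b * a * b) :
    b * x * ((T + c * a) * ((1 + a * x) * B)) + c * ((1 + b * x) * ((1 + a * x) * B) * b) =
      (T + c * a) * (b * x * ((1 + a * x) * B)) + c * (b * ((1 + a * x) * B)) := by
  have hab' : b * (a * b) = a * (b * a) := by rw [← mul_assoc, ← mul_assoc, hab]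
  have haa' : ∀ y, a * (a * y) = 0 := fun y => by rw [← mul_assoc, haa, zero_mul]
  have hbb' : ∀ y, b * (b * y) = 0 := fun y => by rw [← mul_assoc, hbb, zero_mul]
  have hab'' : ∀ y, b * (a * (b * y)) = a * (b * (a * y)) := fun y => by
    rw [← mul_assoc a, ← mul_assoc b, hab', mul_assoc, mul_assoc]
  simp only [mul_add, add_mul, mul_assoc, one_mul, (hx b).eq, (hx B).eq, (hx a).left_comm,
    (hx b).left_comm, (hx T).left_comm, (hx B).left_comm, ← (hc b).left_comm, ← (hc x).left_comm,
    hT.left_comm, ← hB.eq, ← hB.left_comm, haa', hbb', hab'', mul_zero]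
  abel

theorem nilFactor_step (b x c T S A D : R) (hc : ∀ p, Commute c p) (hbb : b * b = 0)
    (hD : D + A * S = T * A)
    (h : b * x * (T * A) + c * ((1 + b * x) * A * b) = T * (b * x * A) + c * (b * A)) :
    b * A + (1 + b * x) * D + (1 + b * x) * A * (S + c * b) =
      (T + (c + 1) * b) * ((1 + b * x) * A) := by
  have hbb' : (c + 1) * b * (b * x * A) = 0 := by
    rw [mul_assoc, mul_assoc b x, ← mul_assoc b, hbb, zero_mul, mul_zero]
  have hcb : (1 + b * x) * A * (c * b) = c * ((1 + b * x) * A * b) := by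
    rw [← mul_assoc, ← (hc _).eq, mul_assoc]
  calc _ = b * A + (1 + b * x) * (D + A * S) + (1 + b * x) * A * (c * b) := by
        simp only [mul_add, mul_assoc]; abel
    _ = b * A + T * A + (b * x * (T * A) + c * ((1 + b * x) * A * b)) := by
        rw [hD, hcb, add_mul, one_mul]; abel
    _ = _ := by
        rw [h, add_mul 1, one_mul, mul_add, add_mul T, add_mul T, hbb', add_mul c, one_mul, add_mul]
        simp only [mul_assoc]
        abel

theorem derivative_nilFactor (u : ℕ → R) (h : IsNilCoxeter u) (m : ℕ) :
    derivative (nilFactor u m) + nilFactor u m * ∑ k ∈ Finset.range m, (k : R[X]) * C (u k) =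
      (∑ k ∈ Finset.range m, (k + 1 : R[X]) * C (u k)) * nilFactor u m := by
  induction m with
  | zero => simp [nilFactor]
  | succ m ih =>
    have hsq : ∀ l, C (u l) * C (u l) = 0 := fun l => by rw [← C_mul, h.sq, C_0]
    have hX : ∀ p : R[X], Commute X p := fun p => X_mul
    rw [Finset.sum_range_succ, Finset.sum_range_succ]
    have hder : derivative (nilFactor u (m + 1)) =
        C (u m) * nilFactor u m + (1 + C (u m) * X) * derivative (nilFactor u m) := by
      rw [nilFactor, derivative_mul]
      simp [derivative_mul]
    rw [hder]
    refine nilFactor_step _ _ _ _ _ _ _ (Nat.cast_commute m) (hsq m) ih ?_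
    rcases m with _ | j
    · simp
    · rw [Finset.sum_range_succ]
      simp only [← Nat.cast_succ]
      refine nilCoxeter_exchange _ _ _ _ _ _ hX (Nat.cast_commute _) ?_
        (commute_nilFactor u h j (j + 1) le_rfl) (hsq _) (hsq _) (by simp only [← C_mul, h.braid])
      refine Commute.sum_right _ _ _ fun k hk => Commute.mul_right (Nat.commute_cast _ _) ?_
      have := Finset.mem_range.1 hk
      exact (show Commute (u k) (u (j + 1)) from h.comm k _ (by omega)).symm.map C

theorem derivative_nilProduct (u : ℕ → R) (h : IsNilCoxeter u) (m : ℕ) :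
    derivative (nilProduct u m) =
      (∑ k ∈ Finset.range m, (k + 1 : R[X]) * C (u k)) * nilProduct u m := by
  induction m generalizing u with
  | zero => simp [nilProduct]
  | succ m ih =>
    rw [nilProduct, derivative_mul, ih _ h.shift, ← mul_assoc (∑ k ∈ Finset.range (m + 1), _),
      ← derivative_nilFactor u h, add_mul, Finset.sum_range_succ']
    simp [mul_assoc]

theorem natDegree_nilFactor_le (u : ℕ → R) (m : ℕ) : (nilFactor u m).natDegree ≤ m := by
  induction m with
  | zero => simp [nilFactor]
  | succ m ih =>
    rw [nilFactor, add_comm m 1]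
    refine natDegree_mul_le_of_le ?_ ih
    compute_degree

theorem natDegree_nilProduct_le (u : ℕ → R) (m : ℕ) :
    (nilProduct u m).natDegree ≤ (m + 1).choose 2 := by
  induction m generalizing u with
  | zero => simp [nilProduct]
  | succ m ih =>
    rw [nilProduct, Nat.choose_succ_succ' (m + 1) 1, Nat.choose_one_right]
    exact natDegree_mul_le_of_le (natDegree_nilFactor_le _ _) (ih _)

theorem coeff_nilFactor_mem (u : ℕ → R) (M : Submonoid R) (hu : ∀ k, u k ∈ M) (m : ℕ) :
    (nilFactor u m).coeff m ∈ M := by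
  induction m with
  | zero => simp [nilFactor, M.one_mem]
  | succ m ih =>
    rw [nilFactor, add_comm m 1, coeff_mul_add_eq_of_natDegree_le (by compute_degree)
      (natDegree_nilFactor_le _ _)]
    refine M.mul_mem ?_ ih
    simpa [coeff_one] using hu m

theorem coeff_nilProduct_mem (u : ℕ → R) (M : Submonoid R) (hu : ∀ k, u k ∈ M) (m : ℕ) :
    (nilProduct u m).coeff ((m + 1).choose 2) ∈ M := by
  induction m generalizing u with
  | zero => simp [nilProduct, M.one_mem]
  | succ m ih =>
    rw [nilProduct, Nat.choose_succ_succ' (m + 1) 1, Nat.choose_one_right,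
      coeff_mul_add_eq_of_natDegree_le (natDegree_nilFactor_le _ _) (natDegree_nilProduct_le _ _)]
    exact M.mul_mem (coeff_nilFactor_mem u M hu _) (ih _ fun k => hu _)

theorem coeff_zero_nilProduct (u : ℕ → R) (m : ℕ) : (nilProduct u m).coeff 0 = 1 := by
  induction m generalizing u with
  | zero => simp [nilProduct]
  | succ m ih =>
    have hf : ∀ l, (nilFactor u l).coeff 0 = 1 := by
      intro l
      induction l with
      | zero => simp [nilFactor]
      | succ l ih => rw [nilFactor, mul_coeff_zero, ih]; simp
    rw [nilProduct, mul_coeff_zero, hf, one_mul, ih]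

theorem pow_sum_eq_factorial_mul_coeff_nilProduct (u : ℕ → R) (h : IsNilCoxeter u) (m d : ℕ) :
    (∑ k ∈ Finset.range m, (k + 1 : R) * u k) ^ d =
      (d.factorial : R) * (nilProduct u m).coeff d := by
  induction d with
  | zero => simp [coeff_zero_nilProduct]
  | succ d ih =>
    have hC : (∑ k ∈ Finset.range m, (k + 1 : R[X]) * C (u k)) =
        C (∑ k ∈ Finset.range m, (k + 1 : R) * u k) := by
      simp
    have := congrArg (fun p => coeff p d) (derivative_nilProduct u h m)
    simp only [coeff_derivative, hC, coeff_C_mul] at this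
    rw [pow_succ', ih, ← mul_assoc, ← (Nat.cast_commute d.factorial _).eq, mul_assoc, ← this,
      Nat.factorial_succ]
    push_cast
    rw [← Nat.cast_succ, (Nat.commute_cast _ (d + 1)).eq, ← mul_assoc,
      (Nat.cast_commute d.factorial ((d + 1 : ℕ) : R)).eq]

end NilCoxeter

section DescentOperators

variable {n : ℕ}

/-- The operator on functions of permutations sending `f` to
`w ↦ f (t_{ij} w)` if `w⁻¹ j < w⁻¹ i` and `w ↦ 0` otherwise. -/
noncomputable def descentOp (i j : Fin (n + 1)) :
    Module.End ℚ (Equiv.Perm (Fin (n + 1)) → ℚ) where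
  toFun f w := if w⁻¹ j < w⁻¹ i then f (Equiv.swap i j * w) else 0
  map_add' f g := by
    ext w
    simp only [Pi.add_apply]
    split_ifs <;> simp
  map_smul' c f := by
    ext w
    simp only [Pi.smul_apply, RingHom.id_apply]
    split_ifs <;> simp

theorem descentOp_apply (i j : Fin (n + 1)) (f : Equiv.Perm (Fin (n + 1)) → ℚ)
    (w : Equiv.Perm (Fin (n + 1))) :
    descentOp i j f w = if w⁻¹ j < w⁻¹ i then f (Equiv.swap i j * w) else 0 := rfl

theorem descentOp_mul_self (i j : Fin (n + 1)) : descentOp i j * descentOp i j = 0 := by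
  refine LinearMap.ext fun f => funext fun w => ?_
  simp only [Module.End.mul_apply, descentOp_apply, mul_inv_rev,
    Equiv.swap_inv, Equiv.Perm.mul_apply, Equiv.swap_apply_left, Equiv.swap_apply_right]
  split_ifs with h1 h2
  · exact absurd h1 (not_lt.2 h2.le)
  · simp
  · simp

theorem descentOp_comm (i j k l : Fin (n + 1)) (hij : i ≠ j) (hkl : k ≠ l)
    (hik : i ≠ k) (hil : i ≠ l) (hjk : j ≠ k) (hjl : j ≠ l) :
    descentOp i j * descentOp k l = descentOp k l * descentOp i j := by
  refine LinearMap.ext fun f => funext fun w => ?_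
  have hc : Equiv.swap i j * Equiv.swap k l = Equiv.swap k l * Equiv.swap i j :=
    (Equiv.Perm.disjoint_swap_swap (by simp_all)).commute
  simp only [Module.End.mul_apply, descentOp_apply, mul_inv_rev, Equiv.swap_inv,
    Equiv.Perm.mul_apply, Equiv.swap_apply_of_ne_of_ne hik hil,
    Equiv.swap_apply_of_ne_of_ne hjk hjl, Equiv.swap_apply_of_ne_of_ne hik.symm hjk.symm,
    Equiv.swap_apply_of_ne_of_ne hil.symm hjl.symm, ← mul_assoc, hc]
  split_ifs <;> rfl

theorem descentOp_braid (a b c : Fin (n + 1)) (hab : a ≠ b) (hac : a ≠ c) (hbc : b ≠ c) :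
    descentOp a b * descentOp b c * descentOp a b =
      descentOp b c * descentOp a b * descentOp b c := by
  refine LinearMap.ext fun f => funext fun w => ?_
  have hs : Equiv.swap a b * Equiv.swap b c * Equiv.swap a b =
      Equiv.swap b c * Equiv.swap a b * Equiv.swap b c := by
    rw [← swap_eq_swap_mul_swap_mul_swap hac hbc, Equiv.swap_mul_swap_mul_swap hab hac,
      Equiv.swap_comm]
  simp only [Module.End.mul_apply, descentOp_apply, mul_inv_rev, Equiv.swap_inv,
    Equiv.Perm.mul_apply, Equiv.swap_apply_left, Equiv.swap_apply_right,
    Equiv.swap_apply_of_ne_of_ne hab hac, Equiv.swap_apply_of_ne_of_ne hac.symm hbc.symm,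
    ← mul_assoc, hs]
  split_ifs <;> rfl

/-- The operator `descentOp` for the `k`-th adjacent transposition, and `0` if there is none. -/
noncomputable def adjDescentOp (n k : ℕ) : Module.End ℚ (Equiv.Perm (Fin (n + 1)) → ℚ) :=
  if h : k < n then descentOp (⟨k, h⟩ : Fin n).castSucc (⟨k, h⟩ : Fin n).succ else 0

theorem isNilCoxeter_adjDescentOp : IsNilCoxeter (adjDescentOp n) where
  sq k := by
    unfold adjDescentOp
    split_ifs
    · exact descentOp_mul_self _ _
    · exact zero_mul _
  comm k l hkl := by
    unfold adjDescentOp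
    split_ifs
    · apply descentOp_comm <;> simp only [ne_eq, Fin.ext_iff, Fin.val_castSucc, Fin.val_succ] <;>
        omega
    all_goals simp
  braid k := by
    unfold adjDescentOp
    split_ifs with h1 h2
    · have : (⟨k, h1⟩ : Fin n).succ = (⟨k + 1, h2⟩ : Fin n).castSucc := rfl
      rw [this]
      apply descentOp_braid <;> simp only [ne_eq, Fin.ext_iff, Fin.val_castSucc, Fin.val_succ] <;>
        omega
    all_goals simp

theorem sum_adjDescentOp_apply (f : Equiv.Perm (Fin (n + 1)) → ℚ) (w : Equiv.Perm (Fin (n + 1))) :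
    (∑ k ∈ Finset.range n, (k + 1 : Module.End ℚ (Equiv.Perm (Fin (n + 1)) → ℚ)) *
      adjDescentOp n k) f w =
    ∑ k : Fin n, ((k : ℕ) + 1 : ℚ) *
      if w⁻¹ k.succ < w⁻¹ k.castSucc then f (adjTransp k * w) else 0 := by
  rw [Finset.sum_range, LinearMap.sum_apply, Finset.sum_apply]
  refine Finset.sum_congr rfl fun k _ => ?_
  have hcast : ((k : ℕ) + 1 : Module.End ℚ (Equiv.Perm (Fin (n + 1)) → ℚ)) =
      ((k : ℕ) + 1 : ℚ) • 1 := by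
    ext; simp [add_smul]
  rw [hcast, Module.End.mul_apply, LinearMap.smul_apply, Module.End.one_apply, Pi.smul_apply,
    smul_eq_mul, adjDescentOp, dif_pos k.2, descentOp_apply]
  rfl

theorem pow_sum_adjDescentOp_apply (m : ℕ) (w : Equiv.Perm (Fin (n + 1))) (hw : invCount w = m) :
    ((∑ k ∈ Finset.range n, (k + 1 : Module.End ℚ (Equiv.Perm (Fin (n + 1)) → ℚ)) *
      adjDescentOp n k) ^ m) (Pi.single 1 1) w = wordSum m w := by
  induction m generalizing w with
  | zero => simp [wordSum_zero, Pi.single_apply]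
  | succ m ih =>
    rw [pow_succ', Module.End.mul_apply, sum_adjDescentOp_apply, wordSum_succ]
    refine Finset.sum_congr rfl fun k _ => ?_
    congr 1
    split_ifs with h
    · have := invCount_adjTransp_mul_of_gt w k h
      exact ih (adjTransp k * w) (by omega)
    · have := invCount_adjTransp_mul_of_lt w k
        (lt_of_le_of_ne (not_lt.1 h) (inv_castSucc_ne_inv_succ w k))
      rw [wordSum_eq_zero]
      omega

theorem reducedWordSum_eq_factorial (w : Equiv.Perm (Fin (n + 1)))
    (hw : invCount w = (n + 1).choose 2) :
    reducedWordSum w = ((n + 1).choose 2).factorial := by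
  let M : Submonoid (Module.End ℚ (Equiv.Perm (Fin (n + 1)) → ℚ)) :=
    { carrier := {T | ∀ f, (∀ v, f v = 0 ∨ f v = 1) → ∀ v, T f v = 0 ∨ T f v = 1}
      mul_mem' := fun {S T} hS hT f hf => hS (T f) (hT f hf)
      one_mem' := fun f hf => hf }
  have hM : ∀ k, adjDescentOp n k ∈ M := by
    intro k f hf v
    unfold adjDescentOp
    split_ifs
    · rw [descentOp_apply]
      split_ifs
      · exact hf _
      · exact Or.inl rfl
    · exact Or.inl rfl
  have h1 := coeff_nilProduct_mem (adjDescentOp n) M hM n (Pi.single 1 1) (fun v => by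
    by_cases hv : v = 1 <;> simp [hv]) w
  have h2 := pow_sum_adjDescentOp_apply _ w hw
  rw [pow_sum_eq_factorial_mul_coeff_nilProduct _ isNilCoxeter_adjDescentOp, ← hw,
    ← reducedWordSum, hw] at h2
  have hcast : (((n + 1).choose 2).factorial : Module.End ℚ (Equiv.Perm (Fin (n + 1)) → ℚ)) =
      (((n + 1).choose 2).factorial : ℚ) • 1 := by
    ext; simp
  rw [hcast, Module.End.mul_apply, LinearMap.smul_apply, Module.End.one_apply, Pi.smul_apply,
    smul_eq_mul] at h2
  rcases h1 with h1 | h1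
  · rw [h1, mul_zero] at h2
    exact absurd h2 (reducedWordSum_pos w).ne
  · rw [h1, mul_one] at h2
    exact h2.symm

end DescentOperators

section Commutation

variable {n : ℕ}

theorem perm_inv_apply_self {α : Type*} (w : Equiv.Perm α) (x : α) : w⁻¹ (w x) = x :=
  w.symm_apply_apply x

theorem perm_apply_inv_self {α : Type*} (w : Equiv.Perm α) (x : α) : w (w⁻¹ x) = x :=
  w.apply_symm_apply x

theorem bQ_adjTransp_mul (w : Equiv.Perm (Fin (n + 1))) (k : Fin n) (i j : Fin (n + 1))
    (hk : invCount (adjTransp k * w) + 1 = invCount w)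
    (hs : invCount (adjTransp k * w * Equiv.swap i j) = invCount w) :
    bQ (adjTransp k * w) i j = bQ w i j := by
  have hmid := fun m => not_between_of_invCount_mul_swap (adjTransp k * w) i j m (by omega)
  have hlt := lt_of_invCount_mul_swap (adjTransp k * w) i j
  have hd := (invCount_adjTransp_mul_add_one_eq_iff w k).1 hk
  have hss : ∀ x, adjTransp k (adjTransp k x) = x := fun x => Equiv.swap_apply_self _ _ x
  have hc : adjTransp k k.castSucc = k.succ := Equiv.swap_apply_left _ _
  have hsu : adjTransp k k.succ = k.castSucc := Equiv.swap_apply_right _ _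
  unfold bQ
  congr 1
  refine Finset.filter_congr fun m _ => and_congr_right fun him => and_congr_right fun hmj => ?_
  rw [Equiv.Perm.mul_apply, Equiv.Perm.mul_apply]
  constructor
  · intro h
    by_contra hcon
    have := adjTransp_lt_adjTransp k h ?_
    · rw [hss, hss] at this
      exact hcon this
    · rintro ⟨h1, h2⟩
      have h1' : w j = k.succ := by rw [← hss (w j), h1, hc]
      have h2' : w m = k.castSucc := by rw [← hss (w m), h2, hsu]
      rw [← h1', ← h2', perm_inv_apply_self, perm_inv_apply_self] at hd
      exact absurd hd (not_lt.2 hmj.le)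
  · intro h
    refine adjTransp_lt_adjTransp k h ?_
    rintro ⟨h1, h2⟩
    have hij := hlt (him.trans hmj) (by omega)
    have hm := hmid m him hmj
    have hne : (adjTransp k * w) i ≠ (adjTransp k * w) m := by simpa using him.ne
    have e1 : (adjTransp k * w) j = k.succ := by rw [Equiv.Perm.mul_apply, h1, hc]
    have e2 : (adjTransp k * w) m = k.castSucc := by rw [Equiv.Perm.mul_apply, h2, hsu]
    rw [e1, e2] at hm
    rw [e1] at hij
    rw [e2] at hne
    simp only [Fin.lt_def, Fin.ext_iff, ne_eq, Fin.val_castSucc, Fin.val_succ] at hm hij hne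
    omega

theorem invCount_commutation_iff (w : Equiv.Perm (Fin (n + 1))) (k : Fin n) (i j : Fin (n + 1))
    (hij : i < j) (hne : adjTransp k * w * Equiv.swap i j ≠ w)
    (hs : invCount (adjTransp k * w * Equiv.swap i j) = invCount w) :
    invCount (w * Equiv.swap i j) = invCount w + 1 ↔
      invCount (adjTransp k * w) + 1 = invCount w := by
  constructor
  · intro h
    refine (invCount_adjTransp_mul_cases w k).resolve_left fun hk => hne ?_
    rw [adjTransp_mul_eq_mul_swap w k i j hij h hk (by rw [← mul_assoc, hs]), mul_assoc,
      Equiv.swap_mul_self, mul_one]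
  · intro h
    have h1 := invCount_adjTransp_mul_cases (w * Equiv.swap i j) k
    rw [← mul_assoc, hs] at h1
    rcases h1 with h1 | h1
    · refine absurd ?_ hne
      rw [← adjTransp_mul_eq_mul_swap (adjTransp k * w) k i j hij (by omega)
        (by rw [adjTransp_mul_adjTransp_mul]; omega)
        (by rw [mul_assoc, adjTransp_mul_adjTransp_mul]; omega), adjTransp_mul_adjTransp_mul]
    · exact h1.symm

theorem adjTransp_mul_mul_swap_eq_iff (w : Equiv.Perm (Fin (n + 1))) (k : Fin n)
    (i j : Fin (n + 1)) (hij : i < j) :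
    adjTransp k * w * Equiv.swap i j = w ↔
      (i = w⁻¹ k.castSucc ∧ j = w⁻¹ k.succ) ∨ (i = w⁻¹ k.succ ∧ j = w⁻¹ k.castSucc) := by
  have key : adjTransp k * w = w * Equiv.swap (w⁻¹ k.castSucc) (w⁻¹ k.succ) := by
    rw [Equiv.mul_swap_eq_swap_mul, perm_apply_inv_self, perm_apply_inv_self, adjTransp]
  rw [key, mul_assoc, mul_eq_left, mul_eq_one_iff_eq_inv, Equiv.swap_inv]
  constructor
  · intro h
    have h1 : Equiv.swap (w⁻¹ k.castSucc) (w⁻¹ k.succ) i = j := by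
      rw [h, Equiv.swap_apply_left]
    rw [Equiv.swap_apply_def] at h1
    split_ifs at h1 with h2 h3
    · exact Or.inl ⟨h2, h1.symm⟩
    · exact Or.inr ⟨h3, h1.symm⟩
    · exact absurd h1 hij.ne
  · rintro (⟨rfl, rfl⟩ | ⟨rfl, rfl⟩)
    · rfl
    · exact Equiv.swap_comm _ _

theorem card_filter_lt : (Finset.univ.filter
    (fun p : Fin n × Fin n => p.1 < p.2)).card = n.choose 2 := by
  have : ∀ y : Fin n, (∑ x : Fin n, if x < y then 1 else 0) = (y : ℕ) := fun y => by
    rw [← Finset.sum_filter, ← Finset.card_eq_sum_ones, ← Fin.card_Iio y]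
    congr 1
    ext; simp
  rw [Finset.card_filter, Fintype.sum_prod_type_right]
  simp only [this]
  rw [← Finset.sum_range (fun i => i), Finset.sum_range_id, Nat.choose_two_right]

/-- The number of non-inversions minus the number of inversions of `w⁻¹` whose smaller
entry is `l`. -/
noncomputable def signSum (w : Equiv.Perm (Fin (n + 1))) (l : Fin (n + 1)) : ℚ :=
  ∑ m, if l < m then (if w⁻¹ l < w⁻¹ m then 1 else -1) else 0

theorem signSum_last (w : Equiv.Perm (Fin (n + 1))) : signSum w (Fin.last n) = 0 :=
  Finset.sum_eq_zero fun m _ => if_neg (not_lt.2 (Fin.le_last m))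

theorem sum_signSum (w : Equiv.Perm (Fin (n + 1))) :
    ∑ l, signSum w l = (n + 1).choose 2 - 2 * invCount w := by
  unfold signSum
  rw [← card_filter_lt, ← invCount_inv w, invCount, Finset.card_filter, Finset.card_filter,
    ← Fintype.sum_prod_type']
  push_cast
  rw [Finset.mul_sum, ← Finset.sum_sub_distrib]
  refine Finset.sum_congr rfl fun p _ => ?_
  by_cases h : p.1 < p.2
  · have hne : w⁻¹ p.1 ≠ w⁻¹ p.2 := by simpa using h.ne
    generalize w⁻¹ p.1 = x at hne ⊢
    generalize w⁻¹ p.2 = y at hne ⊢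
    rcases lt_or_gt_of_ne hne with h1 | h1
    · simp [h, h1, h1.not_gt]
    · simp [h, h1, h1.not_gt]
      norm_num
  · simp [h]

theorem sum_mul_sub (f : Fin (n + 1) → ℚ) :
    ∑ k : Fin n, ((k : ℕ) + 1 : ℚ) * (f k.castSucc - f k.succ) =
      ∑ k, f k - (n + 1) * f (Fin.last n) := by
  induction n with
  | zero => simp
  | succ n ih =>
    rw [Fin.sum_univ_castSucc, Fin.sum_univ_castSucc f]
    have := ih (fun k => f k.castSucc)
    simp only [Fin.val_castSucc, Fin.succ_castSucc, Fin.val_last, Fin.succ_last] at this ⊢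
    rw [this]
    push_cast
    ring

theorem signSum_sub_eq_sum (w : Equiv.Perm (Fin (n + 1))) (k : Fin n) :
    signSum w k.castSucc - signSum w k.succ =
      (if w⁻¹ k.castSucc < w⁻¹ k.succ then 1 else -1) +
      ∑ m, if k.succ < m then
        ((if w⁻¹ k.castSucc < w⁻¹ m then 1 else -1) - (if w⁻¹ k.succ < w⁻¹ m then 1 else -1) : ℚ)
        else 0 := by
  have h1 : (if w⁻¹ k.castSucc < w⁻¹ k.succ then 1 else -1 : ℚ) =
      ∑ m, if m = k.succ then (if w⁻¹ k.castSucc < w⁻¹ m then 1 else -1) else 0 := by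
    rw [Finset.sum_ite_eq' Finset.univ, if_pos (Finset.mem_univ _)]
  rw [h1, signSum, signSum, ← Finset.sum_sub_distrib, ← Finset.sum_add_distrib]
  refine Finset.sum_congr rfl fun m _ => ?_
  have e : k.castSucc < m ↔ m = k.succ ∨ k.succ < m := by
    simp only [Fin.lt_def, Fin.ext_iff, Fin.val_castSucc, Fin.val_succ]
    omega
  by_cases h : m = k.succ
  · subst h
    simp only [Fin.castSucc_lt_succ, lt_irrefl, if_true, if_false, sub_zero, add_zero]
  · simp only [e, h, false_or, if_false, zero_add]
    split_ifs <;> simp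

theorem signSum_sub_of_lt (w : Equiv.Perm (Fin (n + 1))) (k : Fin n)
    (h : w⁻¹ k.castSucc < w⁻¹ k.succ) :
    signSum w k.castSucc - signSum w k.succ =
      1 + 2 * (bQ w (w⁻¹ k.castSucc) (w⁻¹ k.succ) : ℚ) := by
  rw [bQ, Finset.card_filter, ← Equiv.sum_comp w⁻¹, signSum_sub_eq_sum, if_pos h]
  push_cast
  rw [Finset.mul_sum]
  congr 1
  refine Finset.sum_congr rfl fun m _ => ?_
  rw [perm_apply_inv_self, perm_apply_inv_self]
  by_cases hm : k.succ < m
  · have hne : w⁻¹ m ≠ w⁻¹ k.succ := by simpa using hm.ne'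
    generalize w⁻¹ m = x at *
    generalize w⁻¹ k.castSucc = y at *
    generalize w⁻¹ k.succ = z at *
    rcases lt_or_gt_of_ne hne with hx | hx
    · by_cases hy : y < x <;> simp [hm, hx, hx.not_gt, hy]
      norm_num
    · simp [hm, hx, hx.not_gt, h.trans hx]
  · simp [hm]

theorem signSum_sub_of_gt (w : Equiv.Perm (Fin (n + 1))) (k : Fin n)
    (h : w⁻¹ k.succ < w⁻¹ k.castSucc) :
    signSum w k.castSucc - signSum w k.succ =
      -(1 + 2 * (bQ (adjTransp k * w) (w⁻¹ k.succ) (w⁻¹ k.castSucc) : ℚ)) := by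
  rw [bQ, Finset.card_filter, ← Equiv.sum_comp w⁻¹, signSum_sub_eq_sum, if_neg h.not_gt]
  rw [Nat.cast_sum, neg_add, Finset.mul_sum, ← Finset.sum_neg_distrib]
  congr 1
  refine Finset.sum_congr rfl fun m _ => ?_
  simp only [Nat.cast_ite, Nat.cast_one, Nat.cast_zero, Equiv.Perm.mul_apply, perm_apply_inv_self]
  have hc : adjTransp k k.castSucc = k.succ := Equiv.swap_apply_left _ _
  rw [hc]
  by_cases h1 : m = k.castSucc
  · subst h1
    simp [(Fin.castSucc_lt_succ (i := k)).not_gt]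
  by_cases h2 : m = k.succ
  · subst h2
    simp
  have hs : adjTransp k m = m := Equiv.swap_apply_of_ne_of_ne h1 h2
  rw [hs]
  by_cases hm : k.succ < m
  · have hne : w⁻¹ m ≠ w⁻¹ k.castSucc := by simpa using h1
    have hne' : w⁻¹ m ≠ w⁻¹ k.succ := by simpa using h2
    generalize w⁻¹ m = x at *
    generalize w⁻¹ k.castSucc = y at *
    generalize w⁻¹ k.succ = z at *
    rcases lt_or_gt_of_ne hne with hx | hx
    · by_cases hy : z < x <;> simp [hm, hx, hx.not_gt, hy]
      norm_num
    · simp [hm, hx, hx.not_gt, h.trans hx]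
  · simp [hm]

end Commutation

section BruhatSum

variable {n : ℕ}

theorem bruhat_term_commutation (w : Equiv.Perm (Fin (n + 1))) (k : Fin n) (i j : Fin (n + 1))
    (hij : i < j) :
    (if invCount (w * Equiv.swap i j) = invCount w + 1 then
      (1 + 2 * (bQ w i j : ℚ)) *
        (if invCount (adjTransp k * (w * Equiv.swap i j)) + 1 = invCount (w * Equiv.swap i j) then
          ((k : ℕ) + 1 : ℚ) * reducedWordSum (adjTransp k * (w * Equiv.swap i j)) else 0)
      else 0) =
    (if invCount (adjTransp k * w) + 1 = invCount w then
      ((k : ℕ) + 1 : ℚ) *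
        (if invCount (adjTransp k * w * Equiv.swap i j) = invCount (adjTransp k * w) + 1 then
          (1 + 2 * (bQ (adjTransp k * w) i j : ℚ)) *
            reducedWordSum (adjTransp k * w * Equiv.swap i j) else 0)
      else 0) +
    (if adjTransp k * w * Equiv.swap i j = w then
      ((k : ℕ) + 1 : ℚ) * ((if invCount (adjTransp k * w) = invCount w + 1 then
        1 + 2 * (bQ w i j : ℚ) else -(1 + 2 * (bQ (adjTransp k * w) i j : ℚ))) *
          reducedWordSum w)
      else 0) := by
  rw [← mul_assoc]
  by_cases hE : adjTransp k * w * Equiv.swap i j = w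
  · have hw : w * Equiv.swap i j = adjTransp k * w := by
      rw [← adjTransp_mul_adjTransp_mul k (w * Equiv.swap i j), ← mul_assoc _ w, hE]
    rw [hE, hw, if_pos rfl]
    rcases invCount_adjTransp_mul_cases w k with h | h
    · rw [if_pos h, if_pos h.symm, if_neg (by omega), if_pos h]
      ring
    · rw [if_neg (by omega), if_pos h, if_pos h.symm, if_neg (by omega)]
      ring
  · rw [if_neg hE, add_zero]
    by_cases hs : invCount (adjTransp k * w * Equiv.swap i j) = invCount w
    · have hiff := invCount_commutation_iff w k i j hij hE hs
      by_cases h : invCount (adjTransp k * w) + 1 = invCount w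
      · have h' := hiff.2 h
        rw [if_pos h', if_pos h, if_pos (by omega), if_pos (by omega),
          bQ_adjTransp_mul w k i j h hs]
        ring
      · rw [if_neg h, if_neg (mt hiff.1 h)]
    · split_ifs <;> first | omega | simp

theorem sum_adjTransp_mul_mul_swap_eq (w : Equiv.Perm (Fin (n + 1))) (k : Fin n) :
    (∑ p ∈ Finset.univ.filter (fun p : Fin (n + 1) × Fin (n + 1) => p.1 < p.2),
      if adjTransp k * w * Equiv.swap p.1 p.2 = w then
        ((k : ℕ) + 1 : ℚ) * ((if invCount (adjTransp k * w) = invCount w + 1 then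
          1 + 2 * (bQ w p.1 p.2 : ℚ) else -(1 + 2 * (bQ (adjTransp k * w) p.1 p.2 : ℚ))) *
            reducedWordSum w)
        else 0) =
      ((k : ℕ) + 1 : ℚ) * (signSum w k.castSucc - signSum w k.succ) * reducedWordSum w := by
  rcases lt_or_gt_of_ne (inv_castSucc_ne_inv_succ w k) with h | h
  · rw [Finset.sum_eq_single_of_mem (w⁻¹ k.castSucc, w⁻¹ k.succ)
      (by rw [Finset.mem_filter]; exact ⟨Finset.mem_univ _, h⟩)]
    · rw [if_pos ((adjTransp_mul_mul_swap_eq_iff w k _ _ h).2 (Or.inl ⟨rfl, rfl⟩)),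
        if_pos ((invCount_adjTransp_mul_eq_add_one_iff w k).2 h), signSum_sub_of_lt w k h]
      ring
    · rintro ⟨i, j⟩ hp hne
      rw [Finset.mem_filter] at hp
      refine if_neg fun hE => ?_
      rcases (adjTransp_mul_mul_swap_eq_iff w k i j hp.2).1 hE with ⟨h1, h2⟩ | ⟨h1, h2⟩
      · exact hne (Prod.ext h1 h2)
      · have := hp.2
        simp only [h1, h2] at this
        exact this.not_gt h
  · rw [Finset.sum_eq_single_of_mem (w⁻¹ k.succ, w⁻¹ k.castSucc)
      (by rw [Finset.mem_filter]; exact ⟨Finset.mem_univ _, h⟩)]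
    · have h' := (invCount_adjTransp_mul_add_one_eq_iff w k).2 h
      rw [if_pos ((adjTransp_mul_mul_swap_eq_iff w k _ _ h).2 (Or.inr ⟨rfl, rfl⟩)),
        if_neg (by omega), signSum_sub_of_gt w k h]
      ring
    · rintro ⟨i, j⟩ hp hne
      rw [Finset.mem_filter] at hp
      refine if_neg fun hE => ?_
      rcases (adjTransp_mul_mul_swap_eq_iff w k i j hp.2).1 hE with ⟨h1, h2⟩ | ⟨h1, h2⟩
      · have := hp.2
        simp only [h1, h2] at this
        exact this.not_gt h
      · exact hne (Prod.ext h1 h2)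

theorem sum_bQ_mul_reducedWordSum (w : Equiv.Perm (Fin (n + 1))) :
    (∑ p ∈ Finset.univ.filter (fun p : Fin (n + 1) × Fin (n + 1) => p.1 < p.2),
      if invCount (w * Equiv.swap p.1 p.2) = invCount w + 1 then
        (1 + 2 * (bQ w p.1 p.2 : ℚ)) * reducedWordSum (w * Equiv.swap p.1 p.2) else 0) =
      (((n + 1).choose 2 : ℚ) - invCount w) * (invCount w + 1) * reducedWordSum w := by
  induction hl : invCount w using Nat.strong_induction_on generalizing w with
  | _ l ih =>
  subst hl
  have hY : (∑ k : Fin n, if invCount (adjTransp k * w) + 1 = invCount w then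
      ((k : ℕ) + 1 : ℚ) *
        (∑ p ∈ Finset.univ.filter (fun p : Fin (n + 1) × Fin (n + 1) => p.1 < p.2),
        if invCount (adjTransp k * w * Equiv.swap p.1 p.2) = invCount (adjTransp k * w) + 1 then
          (1 + 2 * (bQ (adjTransp k * w) p.1 p.2 : ℚ)) *
            reducedWordSum (adjTransp k * w * Equiv.swap p.1 p.2) else 0)
      else 0) =
      ((n + 1).choose 2 - invCount w + 1) * invCount w * reducedWordSum w := by
    by_cases h0 : invCount w = 0
    · simp [h0]
    · rw [reducedWordSum_eq_sum w h0, Finset.mul_sum]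
      refine Finset.sum_congr rfl fun k _ => ?_
      split_ifs with hk
      · rw [ih _ (by omega) (adjTransp k * w) rfl, ← hk]
        push_cast
        ring
      · simp
  have hZ : (∑ k : Fin n, ((k : ℕ) + 1 : ℚ) * (signSum w k.castSucc - signSum w k.succ) *
      reducedWordSum w) = ((n + 1).choose 2 - 2 * invCount w) * reducedWordSum w := by
    rw [← Finset.sum_mul, sum_mul_sub, signSum_last, sum_signSum, mul_zero, sub_zero]
  calc _ = ∑ p ∈ Finset.univ.filter (fun p : Fin (n + 1) × Fin (n + 1) => p.1 < p.2),
        ∑ k : Fin n, (if invCount (w * Equiv.swap p.1 p.2) = invCount w + 1 then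
          (1 + 2 * (bQ w p.1 p.2 : ℚ)) *
            (if invCount (adjTransp k * (w * Equiv.swap p.1 p.2)) + 1 =
                invCount (w * Equiv.swap p.1 p.2) then
              ((k : ℕ) + 1 : ℚ) * reducedWordSum (adjTransp k * (w * Equiv.swap p.1 p.2)) else 0)
          else 0) := by
        refine Finset.sum_congr rfl fun p _ => ?_
        split_ifs with hp
        · rw [reducedWordSum_eq_sum _ (by omega), Finset.mul_sum]
        · simp
    _ = _ := by
        rw [Finset.sum_comm]
        rw [show ((n + 1).choose 2 - invCount w : ℚ) * (invCount w + 1) * reducedWordSum w =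
            ((n + 1).choose 2 - invCount w + 1) * invCount w * reducedWordSum w +
            ((n + 1).choose 2 - 2 * invCount w) * reducedWordSum w by ring, ← hY, ← hZ,
          ← Finset.sum_add_distrib]
        refine Finset.sum_congr rfl fun k _ => ?_
        rw [Finset.sum_congr rfl fun p hp =>
          bruhat_term_commutation w k p.1 p.2 (Finset.mem_filter.1 hp).2, Finset.sum_add_distrib,
          sum_adjTransp_mul_mul_swap_eq]
        congr 1
        split_ifs
        · rw [Finset.mul_sum]
        · exact Finset.sum_const_zero

end BruhatSum

section CoverSum

variable {n : ℕ}

theorem lt_and_invCount_inv_mul_swap (w : Equiv.Perm (Fin (n + 1))) (i j : Fin (n + 1))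
    (h : i < j ∧ invCount (w * Equiv.swap i j) = invCount w + 1) :
    w i < w j ∧ invCount (w⁻¹ * Equiv.swap (w i) (w j)) = invCount w⁻¹ + 1 := by
  refine ⟨lt_of_invCount_mul_swap w i j h.1 h.2, ?_⟩
  rw [invCount_inv w, ← h.2, ← invCount_inv (w * Equiv.swap i j), mul_inv_rev, Equiv.swap_inv,
    Equiv.mul_swap_eq_swap_mul, perm_inv_apply_self, perm_inv_apply_self]

theorem sum_cQ_mul_reducedWordSum (w : Equiv.Perm (Fin (n + 1))) :
    (∑ p ∈ Finset.univ.filter (fun p : Fin (n + 1) × Fin (n + 1) => p.1 < p.2),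
      if invCount (w * Equiv.swap p.1 p.2) = invCount w + 1 then
        (1 + 2 * (cQ w p.1 p.2 : ℚ)) * reducedWordSum (w * Equiv.swap p.1 p.2) else 0) =
      (((n + 1).choose 2 : ℚ) - invCount w) * (invCount w + 1) * reducedWordSum w := by
  have h := sum_bQ_mul_reducedWordSum w⁻¹
  rw [← Finset.sum_filter, Finset.filter_filter, Finset.sum_filter] at h ⊢
  rw [← Equiv.sum_comp (Equiv.prodCongr w w)] at h
  rw [← reducedWordSum_inv w, ← invCount_inv w, ← h]
  refine Finset.sum_congr rfl fun p _ => ?_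
  have hiff : (p.1 < p.2 ∧ invCount (w * Equiv.swap p.1 p.2) = invCount w⁻¹ + 1) ↔
      (w p.1 < w p.2 ∧ invCount (w⁻¹ * Equiv.swap (w p.1) (w p.2)) = invCount w⁻¹ + 1) := by
    constructor
    · intro hp
      rw [invCount_inv w] at hp
      exact lt_and_invCount_inv_mul_swap w p.1 p.2 hp
    · intro hp
      have := lt_and_invCount_inv_mul_swap w⁻¹ _ _ hp
      rwa [perm_inv_apply_self, perm_inv_apply_self, inv_inv, ← invCount_inv w] at this
  have hM : reducedWordSum (w * Equiv.swap p.1 p.2) =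
      reducedWordSum (w⁻¹ * Equiv.swap (w p.1) (w p.2)) := by
    rw [← reducedWordSum_inv, mul_inv_rev, Equiv.swap_inv,
      Equiv.mul_swap_eq_swap_mul w⁻¹, perm_inv_apply_self, perm_inv_apply_self]
  have hc : cQ w p.1 p.2 = bQ w⁻¹ (w p.1) (w p.2) := by
    rw [bQ, Finset.card_filter, ← Equiv.sum_comp w, cQ, Finset.card_filter]
    refine Finset.sum_congr rfl fun k _ => ?_
    rw [perm_inv_apply_self, perm_inv_apply_self]
    congr 1
    exact propext ⟨fun h => ⟨h.2.1, h.2.2, h.1⟩, fun h => ⟨h.2.2, h.1, h.2.1⟩⟩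
  simp only [Equiv.prodCongr_apply, Prod.map_fst, Prod.map_snd, hiff, hM, hc]

open Polynomial in
theorem sum_wtBC_mul_reducedWordSum (w : Equiv.Perm (Fin (n + 1))) :
    (∑ u ∈ Finset.univ.filter (fun u => BruhatCov w u), wtBC w u * C (reducedWordSum u)) =
      C ((((n + 1).choose 2 : ℚ) - invCount w) * (invCount w + 1) * reducedWordSum w) := by
  have hb := congrArg (fun x => (1 - C (1 / 2) * X) * C x) (sum_bQ_mul_reducedWordSum w)
  have hc := congrArg (fun x => C (1 / 2) * X * C x) (sum_cQ_mul_reducedWordSum w)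
  have h2 : (C (1 / 2) * 2 : Polynomial ℚ) = 1 := by
    rw [show (2 : Polynomial ℚ) = C 2 from rfl, ← C_mul]
    norm_num
  have hbc := congrArg₂ (· + ·) hb hc
  simp only [← add_mul, sub_add_cancel, one_mul, map_sum, Finset.mul_sum,
    ← Finset.sum_add_distrib] at hbc
  rw [← hbc]
  calc _ = ∑ u, ∑ p : Fin (n + 1) × Fin (n + 1),
        if BruhatCov w u ∧ p.1 < p.2 ∧ u = w * Equiv.swap p.1 p.2 then
          (1 + (bQ w p.1 p.2 : Polynomial ℚ) * (2 - X) + (cQ w p.1 p.2 : Polynomial ℚ) * X) *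
            C (reducedWordSum u) else 0 := by
        rw [Finset.sum_filter]
        refine Finset.sum_congr rfl fun u _ => ?_
        by_cases hu : BruhatCov w u
        · simp only [hu, if_true, true_and]
          rw [wtBC, Finset.sum_mul, Finset.sum_filter]
        · simp [hu]
    _ = _ := by
        rw [Finset.sum_comm, Finset.sum_filter]
        refine Finset.sum_congr rfl fun p _ => ?_
        rw [Finset.sum_eq_single (w * Equiv.swap p.1 p.2)]
        · by_cases hp : p.1 < p.2
          · have hiff : BruhatCov w (w * Equiv.swap p.1 p.2) ↔
                invCount (w * Equiv.swap p.1 p.2) = invCount w + 1 :=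
              ⟨fun ⟨_, _, _, _, h⟩ => h, fun h => ⟨p.1, p.2, hp, rfl, h⟩⟩
            simp only [hiff, hp, and_true, if_true]
            split_ifs
            · simp only [C_mul, C_add, C_1, map_natCast, show (C 2 : Polynomial ℚ) = 2 from rfl]
              linear_combination ((cQ w p.1 p.2 : Polynomial ℚ) - bQ w p.1 p.2) * -X *
                C (reducedWordSum (w * Equiv.swap p.1 p.2)) * h2
            · simp
          · simp [hp]
        · intro u _ hu
          exact if_neg fun h => hu h.2.2
        · simp

end CoverSum

section Chains

variable {n : ℕ}

/-- The weighted count of chains of `m` Bruhat covers from `v` to `w`. -/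
noncomputable def chainSumOfLength {R : Type*} [CommSemiring R]
    (wt : Equiv.Perm (Fin n) → Equiv.Perm (Fin n) → R) (m : ℕ) (v w : Equiv.Perm (Fin n)) : R :=
  ∑ c ∈ Finset.univ.filter
      (fun c : Fin (m + 1) → Equiv.Perm (Fin n) =>
        c 0 = v ∧ c (Fin.last _) = w ∧ ∀ i : Fin m, BruhatCov (c i.castSucc) (c i.succ)),
    ∏ i : Fin m, wt (c i.castSucc) (c i.succ)

theorem chainSumOfLength_zero_self {R : Type*} [CommSemiring R]
    (wt : Equiv.Perm (Fin n) → Equiv.Perm (Fin n) → R) (w : Equiv.Perm (Fin n)) :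
    chainSumOfLength wt 0 w w = 1 := by
  rw [chainSumOfLength, Finset.sum_filter, Finset.sum_eq_single (fun _ => w)]
  · rw [if_pos ⟨rfl, rfl, fun i => i.elim0⟩, Fin.prod_univ_zero]
  · intro c _ hc
    refine if_neg fun h => hc ?_
    funext i
    rw [show i = 0 by omega, h.1]
  · exact fun h => absurd (Finset.mem_univ _) h

theorem chainSumOfLength_succ {R : Type*} [CommSemiring R]
    (wt : Equiv.Perm (Fin n) → Equiv.Perm (Fin n) → R) (m : ℕ) (v w : Equiv.Perm (Fin n)) :
    chainSumOfLength wt (m + 1) v w =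
      ∑ u ∈ Finset.univ.filter (fun u => BruhatCov v u), wt v u * chainSumOfLength wt m u w := by
  simp only [chainSumOfLength, Finset.sum_filter]
  rw [← (Fin.consEquiv (fun _ : Fin (m + 2) => Equiv.Perm (Fin n))).sum_comp,
    Fintype.sum_prod_type]
  have hcond : ∀ (x : Equiv.Perm (Fin n)) (c : Fin (m + 1) → Equiv.Perm (Fin n)),
      (∀ i : Fin (m + 1), BruhatCov ((Fin.cons x c : Fin (m + 2) → Equiv.Perm (Fin n)) i.castSucc)
        (c i)) ↔
      BruhatCov x (c 0) ∧ ∀ i : Fin m, BruhatCov (c i.castSucc) (c i.succ) := by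
    intro x c
    rw [Fin.forall_fin_succ]
    simp only [Fin.castSucc_zero, Fin.cons_zero, Fin.cons_succ, Fin.castSucc_succ]
  simp only [Fin.consEquiv_apply, Fin.cons_zero, ← Fin.succ_last, Fin.cons_succ, hcond,
    Fin.prod_univ_succ (n := m), Fin.castSucc_zero, Fin.castSucc_succ]
  rw [Finset.sum_eq_single v]
  · have hR : ∀ u : Equiv.Perm (Fin n), (if BruhatCov v u then wt v u *
        ∑ c : Fin (m + 1) → Equiv.Perm (Fin n), (if c 0 = u ∧ c (Fin.last m) = w ∧
          ∀ i : Fin m, BruhatCov (c i.castSucc) (c i.succ) then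
            ∏ i : Fin m, wt (c i.castSucc) (c i.succ) else 0) else 0) =
        ∑ c : Fin (m + 1) → Equiv.Perm (Fin n), if BruhatCov v u ∧ c 0 = u ∧ c (Fin.last m) = w ∧
          (∀ i : Fin m, BruhatCov (c i.castSucc) (c i.succ)) then
            wt v u * ∏ i : Fin m, wt (c i.castSucc) (c i.succ) else 0 := by
      intro u
      by_cases hu : BruhatCov v u
      · simp only [hu, if_true, true_and, Finset.mul_sum, mul_ite, mul_zero]
      · simp only [hu, if_false, false_and, Finset.sum_const_zero]
    simp only [hR]
    rw [Finset.sum_comm]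
    refine Finset.sum_congr rfl fun c _ => ?_
    rw [Finset.sum_eq_single (c 0)]
    · congr 1
      exact propext (by tauto)
    · exact fun u _ hu => if_neg fun h => hu h.2.1.symm
    · exact fun h => absurd (Finset.mem_univ _) h
  · exact fun x _ hx => Finset.sum_eq_zero fun c _ => if_neg fun h => hx h.1
  · exact fun h => absurd (Finset.mem_univ _) h

theorem invCount_le_choose (w : Equiv.Perm (Fin n)) : invCount w ≤ n.choose 2 := by
  rw [← card_filter_lt, invCount]
  exact Finset.card_le_card (Finset.monotone_filter_right _ fun _ _ h => h.1)

theorem invCount_revPerm : invCount (Fin.revPerm : Equiv.Perm (Fin n)) = n.choose 2 := by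
  rw [← card_filter_lt, invCount]
  congr 1
  refine Finset.filter_congr fun p _ => ?_
  rw [Fin.revPerm_apply, Fin.revPerm_apply, Fin.rev_lt_rev, and_self]

theorem eq_revPerm_of_invCount_eq (w : Equiv.Perm (Fin (n + 1)))
    (hw : invCount w = (n + 1).choose 2) : w = Fin.revPerm := by
  have hanti : ∀ p q : Fin (n + 1), p < q → w q < w p := by
    rw [← card_filter_lt, invCount] at hw
    have := Finset.eq_of_subset_of_card_le
      (Finset.monotone_filter_right _ fun _ _ h => h.1) hw.ge
    intro p q hpq
    have hm : (p, q) ∈ Finset.univ.filter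
        (fun p : Fin (n + 1) × Fin (n + 1) => p.1 < p.2) := by
      rw [Finset.mem_filter]
      exact ⟨Finset.mem_univ _, hpq⟩
    rw [← this, Finset.mem_filter] at hm
    exact hm.2.2
  have h1 := eq_one_of_forall_lt (w * Fin.revPerm) fun k =>
    hanti _ _ (Fin.rev_lt_rev.2 Fin.castSucc_lt_succ)
  rw [mul_eq_one_iff_eq_inv] at h1
  exact h1

open Polynomial in
theorem chainSumOfLength_wtBC (m : ℕ) (w : Equiv.Perm (Fin (n + 1)))
    (hw : invCount w + m = (n + 1).choose 2) :
    chainSumOfLength wtBC m w Fin.revPerm =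
      C ((m.factorial : ℚ) * reducedWordSum w / (invCount w).factorial) := by
  induction m generalizing w with
  | zero =>
    have h0 : invCount w = (n + 1).choose 2 := hw
    have := eq_revPerm_of_invCount_eq w h0
    subst this
    rw [chainSumOfLength_zero_self, reducedWordSum_eq_factorial _ h0, h0, Nat.factorial_zero,
      Nat.cast_one, one_mul, div_self (by positivity), C_1]
  | succ m ih =>
    have hstep : ∀ u ∈ Finset.univ.filter (fun u => BruhatCov w u),
        wtBC w u * chainSumOfLength wtBC m u Fin.revPerm =
          C ((m.factorial : ℚ) / (invCount w + 1).factorial) *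
            (wtBC w u * C (reducedWordSum u)) := by
      intro u hu
      obtain ⟨_, _, _, _, hl⟩ := (Finset.mem_filter.1 hu).2
      rw [ih u (by omega), hl, mul_left_comm, ← C_mul, div_mul_eq_mul_div]
    rw [chainSumOfLength_succ, Finset.sum_congr rfl hstep, ← Finset.mul_sum,
      sum_wtBC_mul_reducedWordSum, ← C_mul, ← hw, Nat.factorial_succ, Nat.factorial_succ]
    congr 1
    push_cast
    field_simp
    ring

end Chains

theorem generalized_macdonald {n : ℕ} (w : Equiv.Perm (Fin (n + 1))) :
    chainSum wtBC w Fin.revPerm =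
      ((((n + 1).choose 2 - invCount w).factorial : Polynomial ℚ)) *
        Polynomial.C (prinSpec w) := by
  have h := chainSumOfLength_wtBC ((n + 1).choose 2 - invCount w) w
    (Nat.add_sub_cancel' (invCount_le_choose w))
  rw [← invCount_revPerm] at h ⊢
  rw [prinSpec_eq_wordSum_div, ← Polynomial.C_eq_natCast, ← Polynomial.C_mul, ← mul_div_assoc]
  exact h
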